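/- arXiv:1903.03551 — 2 statements merged into one kernel-verified Lean document; each statement's English description precedes it below -/
import Mathlib

section
/- Let M be a perfect compact metric space, let X = M^ℤ be endowed with the metric r(x,y) = Σ_{n∈ℤ} min{1/(n²+1), d(x_n,y_n)}, and let T be the full shift on X. Let μ ∈ M(T) and s₀ > 0. Then every weak neighborhood of μ in M(T) contains a T-periodic measure μ_x = (1/s) Σ_{i=0}^{s−1} δ_{T^i x}, where x ∈ X is a T-periodic point of period s ≥ s₀ whose coordinates x_1, …, x_s within one period are pairwise distinct elements of M. -/
open MeasureTheory Filter Topology Metric Set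
open scoped ENNReal NNReal

section Defs

variable {X : Type*} [MetricSpace X] [MeasurableSpace X]

/-- The topological support of a Borel measure on a metric space: the set of points all of whose
balls have positive measure. -/
def msupp (μ : Measure X) : Set X := {x : X | ∀ ε > 0, 0 < μ (ball x ε)}

/-- The energy function `I_μ(q, ε) = ∫_{supp μ} μ(B(x,ε))^(q-1) dμ(x)`. -/
noncomputable def energyI (μ : Measure X) (q ε : ℝ) : ℝ :=
  ∫ x in msupp μ, (μ (ball x ε)).toReal ^ (q - 1) ∂μ

/-- The lower `q`-generalized fractal dimension
`D⁻_μ(q) = liminf_{ε→0⁺} log I_μ(q,ε) / ((q-1) log ε)` (as an extended real number). -/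
noncomputable def Dlower (μ : Measure X) (q : ℝ) : EReal :=
  liminf (fun ε : ℝ =>
    ((Real.log (energyI μ q ε) / ((q - 1) * Real.log ε) : ℝ) : EReal)) (𝓝[>] (0 : ℝ))

/-- The upper `q`-generalized fractal dimension
`D⁺_μ(q) = limsup_{ε→0⁺} log I_μ(q,ε) / ((q-1) log ε)` (as an extended real number). -/
noncomputable def Dupper (μ : Measure X) (q : ℝ) : EReal :=
  limsup (fun ε : ℝ =>
    ((Real.log (energyI μ q ε) / ((q - 1) * Real.log ε) : ℝ) : EReal)) (𝓝[>] (0 : ℝ))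

/-- `∫_{supp μ} log μ(B(x,ε)) dμ(x)`, the numerator in the entropy dimension. -/
noncomputable def entNum (μ : Measure X) (ε : ℝ) : ℝ :=
  ∫ x in msupp μ, Real.log (μ (ball x ε)).toReal ∂μ

/-- The lower entropy dimension
`D⁻_μ(1) = liminf_{ε→0⁺} (∫_{supp μ} log μ(B(x,ε)) dμ(x)) / log ε`. -/
noncomputable def D1lower (μ : Measure X) : EReal :=
  liminf (fun ε : ℝ => ((entNum μ ε / Real.log ε : ℝ) : EReal)) (𝓝[>] (0 : ℝ))

/-- The upper entropy dimension
`D⁺_μ(1) = limsup_{ε→0⁺} (∫_{supp μ} log μ(B(x,ε)) dμ(x)) / log ε`. -/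
noncomputable def D1upper (μ : Measure X) : EReal :=
  limsup (fun ε : ℝ => ((entNum μ ε / Real.log ε : ℝ) : EReal)) (𝓝[>] (0 : ℝ))

/-- A measure is `T`-invariant if `μ(T⁻¹ s) = μ s` for every measurable `s`. -/
def IsInvariantMeasure (T : X → X) (μ : Measure X) : Prop :=
  ∀ s : Set X, MeasurableSet s → μ (T ⁻¹' s) = μ s

/-- `M(T)`: the set of `T`-invariant Borel probability measures on `X`. -/
def invSet (T : X → X) : Set (ProbabilityMeasure X) :=
  {μ : ProbabilityMeasure X | IsInvariantMeasure T μ.toMeasure}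

/-- A `T`-periodic measure: `μ = (1/k) ∑_{i<k} δ_{T^i x}` for a `T`-periodic point `x`
of period `k`. -/
def IsPeriodicMeasure (T : X → X) (μ : ProbabilityMeasure X) : Prop :=
  ∃ (x : X) (k : ℕ), 0 < k ∧ T^[k] x = x ∧
    μ.toMeasure = (k : ℝ≥0∞)⁻¹ • ∑ i ∈ Finset.range k, Measure.dirac (T^[i] x)

/-- The upper Hausdorff dimension of a measure:
`dim_H^+(μ) = inf {dimH E | E Borel, μ(X \ E) = 0}`. -/
noncomputable def dimHplus (μ : Measure X) : ℝ≥0∞ :=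
  ⨅ (E : Set X) (_ : MeasurableSet E) (_ : μ Eᶜ = 0), dimH E

/-- The lower Hausdorff dimension of a measure:
`dim_H^-(μ) = inf {dimH E | E Borel, μ(E) > 0}`. -/
noncomputable def dimHminus (μ : Measure X) : ℝ≥0∞ :=
  ⨅ (E : Set X) (_ : MeasurableSet E) (_ : 0 < μ E), dimH E

/-- The return time `τ_s(x) = inf {k ≥ 1 | T^k x ∈ B(x,s)}`. -/
noncomputable def tauRet (T : X → X) (s : ℝ) (x : X) : ℕ :=
  sInf {k : ℕ | 0 < k ∧ T^[k] x ∈ ball x s}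

/-- The lower recurrence rate `R̲(x) = liminf_{s→0⁺} log τ_s(x) / (-log s)`. -/
noncomputable def Rlower (T : X → X) (x : X) : EReal :=
  liminf (fun s : ℝ =>
    ((Real.log (tauRet T s x : ℝ) / (-Real.log s) : ℝ) : EReal)) (𝓝[>] (0 : ℝ))

open Classical in
/-- The lower local dimension `d̲_μ(x) = liminf_{ε→0⁺} log μ(B(x,ε)) / log ε` when all balls
around `x` have positive measure, and `+∞` otherwise. -/
noncomputable def dLoc (μ : Measure X) (x : X) : EReal :=
  if (∀ ε > 0, 0 < μ (ball x ε)) then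
    liminf (fun ε : ℝ =>
      ((Real.log (μ (ball x ε)).toReal / Real.log ε : ℝ) : EReal)) (𝓝[>] (0 : ℝ))
  else ⊤

/-- The auxiliary continuous kernel `f^ε_x(y)`: equal to `1` if `dist x y ≤ ε`, to
`2 - dist x y / ε` if `ε ≤ dist x y ≤ 2ε`, and to `0` if `dist x y ≥ 2ε`. -/
noncomputable def fker (ε : ℝ) (x y : X) : ℝ :=
  if dist x y ≤ ε then 1 else if dist x y ≤ 2 * ε then 2 - dist x y / ε else 0

/-- `f_ε(μ, x) = ∫ f^ε_x(y) dμ(y)`. -/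
noncomputable def feps (ε : ℝ) (μ : Measure X) (x : X) : ℝ := ∫ y, fker ε x y ∂μ

/-- `G` is a finite covering of `X` by open balls of radius `ε` (given by its finite set of
centers). -/
def IsBallCover (ε : ℝ) (G : Finset X) : Prop := (⋃ x ∈ G, ball x ε) = univ

/-- `S_μ(s,ε) = inf_G ∑_{x ∈ G} μ(B(x,ε))^s`, the infimum running over all finite coverings of
`X` by balls of radius `ε`. -/
noncomputable def Sfun (μ : Measure X) (s ε : ℝ) : ℝ :=
  ⨅ G : {H : Finset X // IsBallCover ε H}, ∑ x ∈ G.val, (μ (ball x ε)).toReal ^ s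

/-- `W_μ(s,ε) = inf_G ∑_{x ∈ G} f_ε(μ,x)^s`, the infimum running over all finite coverings of
`X` by balls of radius `ε`. -/
noncomputable def Wfun (μ : Measure X) (s ε : ℝ) : ℝ :=
  ⨅ G : {H : Finset X // IsBallCover ε H}, ∑ x ∈ G.val, (feps ε μ x) ^ s

/-- The regularized energy function `J_μ(q,ε) = ∫ f_ε(μ,x)^(q-1) dμ(x)`. -/
noncomputable def Jfun (μ : Measure X) (q ε : ℝ) : ℝ :=
  ∫ x, (feps ε μ x) ^ (q - 1) ∂μ

end Defs

section Shift

variable {M : Type*} [MetricSpace M]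

/-- The "cylinder ball" `B^n(x,ε) = {y | d(x_i, y_i) < ε for all |i| ≤ n}` in `M^ℤ`. -/
def cylBall (n : ℕ) (x : ℤ → M) (ε : ℝ) : Set (ℤ → M) :=
  {y : ℤ → M | ∀ i : ℤ, |i| ≤ (n : ℤ) → dist (x i) (y i) < ε}

/-- For `ε ∈ (0,1)`, the largest integer `n ≥ 0` with `ε < 1/(n²+1)`. -/
noncomputable def nZero (ε : ℝ) : ℕ := sSup {n : ℕ | ε < 1 / ((n : ℝ) ^ 2 + 1)}

/-- The modified energy function `I^n_μ(q,ε) = ∫ μ(B^n(x,ε))^(q-1) dμ(x)`. -/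
noncomputable def Icyl [MeasurableSpace (ℤ → M)] (μ : Measure (ℤ → M)) (n : ℕ) (q ε : ℝ) :
    ℝ :=
  ∫ x, (μ (cylBall n x ε)).toReal ^ (q - 1) ∂μ

end Shift


open ProbabilityTheory

/-- In a metric space without isolated points, finitely many terms of any sequence can be made
pairwise distinct by an arbitrarily small perturbation. -/
lemma exists_injOn_dist_lt {M : Type*} [MetricSpace M] (hM : Preperfect (Set.univ : Set M))
    (a : ℕ → M) {δ : ℝ} (hδ : 0 < δ) (N : ℕ) :
    ∃ y : ℕ → M, Set.InjOn y (Set.Iio N) ∧ ∀ p, dist (y p) (a p) < δ := by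
  classical
  induction N with
  | zero => exact ⟨a, by simp, by simpa using hδ⟩
  | succ N ih =>
    obtain ⟨y, hy, hya⟩ := ih
    have hne : (𝓝[≠] (a N)).NeBot := by
      simpa [AccPt] using hM (a N) (Set.mem_univ _)
    obtain ⟨z, hz, hzy⟩ := (infinite_of_mem_nhds (a N) (ball_mem_nhds (a N) hδ)).exists_notMem_finset
      ((Finset.range N).image y)
    refine ⟨Function.update y N z, ?_, fun p => ?_⟩
    · have hzy' : ∀ i < N, y i ≠ z := fun i hi h =>
        hzy (Finset.mem_image.2 ⟨i, Finset.mem_range.2 hi, h⟩)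
      intro i hi j hj hij
      rcases Nat.lt_succ_iff_lt_or_eq.1 hi with hi' | rfl <;>
        rcases Nat.lt_succ_iff_lt_or_eq.1 hj with hj' | rfl
      · rw [Function.update_of_ne hi'.ne, Function.update_of_ne hj'.ne] at hij
        exact hy hi' hj' hij
      · rw [Function.update_of_ne hi'.ne, Function.update_self] at hij
        exact absurd hij (hzy' i hi')
      · rw [Function.update_of_ne hj'.ne, Function.update_self] at hij
        exact absurd hij.symm (hzy' j hj')
      · rfl
    · rcases eq_or_ne p N with rfl | hp
      · simpa using hz
      · simpa [hp] using hya p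

/-- A continuous function on `M^ℤ`, with `M` compact, is determined up to a small error by the
approximate values of the coordinates in a finite window. -/
lemma exists_window_dist_lt {M E : Type*} [PseudoMetricSpace M] [CompactSpace M]
    [PseudoMetricSpace E] {G : (ℤ → M) → E} (hG : Continuous G) {η : ℝ} (hη : 0 < η) :
    ∃ (m : ℕ) (δ : ℝ), 0 < δ ∧ ∀ x y : ℤ → M,
      (∀ i : ℤ, |i| ≤ m → dist (x i) (y i) < δ) → dist (G x) (G y) < η := by
  have h := CompactSpace.uniformContinuous_of_continuous hG (dist_mem_uniformity hη)
  rw [Filter.mem_map, Pi.uniformity] at h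
  have hb := Filter.HasBasis.iInf' (fun i : ℤ =>
    (Metric.uniformity_basis_dist (α := M)).comap
      (fun a : (ℤ → M) × (ℤ → M) => (a.1 i, a.2 i)))
  obtain ⟨⟨I, ε⟩, ⟨hI, hε⟩, hsub⟩ := hb.mem_iff.1 h
  obtain ⟨m, hm⟩ : ∃ m : ℕ, ∀ i ∈ I, |i| ≤ m := by
    obtain ⟨b, hb⟩ := (hI.image (fun i : ℤ => |i|)).bddAbove
    exact ⟨b.toNat, fun i hi => (hb ⟨i, hi, rfl⟩).trans (Int.self_le_toNat b)⟩
  obtain ⟨δ, hδ, hδε⟩ : ∃ δ > 0, ∀ i ∈ I, δ ≤ ε i := by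
    have : ∀ᶠ δ in 𝓝[>] (0 : ℝ), ∀ i ∈ I, δ ≤ ε i :=
      (Filter.eventually_all_finite hI).2 fun i hi =>
        (eventually_le_nhds (hε i hi)).filter_mono nhdsWithin_le_nhds
    obtain ⟨δ, h1, h2⟩ := (this.and self_mem_nhdsWithin).exists
    exact ⟨δ, h2, h1⟩
  refine ⟨m, δ, hδ, fun x y hxy => ?_⟩
  have : (x, y) ∈ ⋂ i ∈ I, (fun a : (ℤ → M) × (ℤ → M) => (a.1 i, a.2 i)) ⁻¹'
      {p : M × M | dist p.1 p.2 < ε i} := by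
    simp only [Set.mem_iInter]
    exact fun i hi => (hxy i (hm i hi)).trans_le (hδε i hi)
  exact hsub this

/-- Empirical means of a bounded measurable vector-valued function along a suitable sequence of
points converge to its integral. -/
lemma exists_seq_tendsto_average {Ω E : Type*} [MeasurableSpace Ω] (μ : Measure Ω)
    [IsProbabilityMeasure μ] [NormedAddCommGroup E] [NormedSpace ℝ E] [CompleteSpace E]
    [MeasurableSpace E] [BorelSpace E] {H : Ω → E} (hH : Measurable H) (hi : Integrable H μ) :
    ∃ w : ℕ → Ω, Tendsto (fun K : ℕ => (K : ℝ)⁻¹ • ∑ k ∈ Finset.range K, H (w k)) atTop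
      (𝓝 (∫ x, H x ∂μ)) := by
  have hmp : ∀ i : ℕ, MeasurePreserving (fun ω : ℕ → Ω => ω i)
      (Measure.infinitePi fun _ => μ) μ := fun i => measurePreserving_eval_infinitePi _ i
  have hindep := iIndepFun_infinitePi (P := fun _ : ℕ => μ) (X := fun _ => H) fun _ => hH
  have hlaw : ∀ i : ℕ, IdentDistrib (fun ω : ℕ → Ω => H (ω i)) (fun ω => H (ω 0))
      (Measure.infinitePi fun _ => μ) (Measure.infinitePi fun _ => μ) := fun i =>
    { aemeasurable_fst := (hH.comp (hmp i).measurable).aemeasurable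
      aemeasurable_snd := (hH.comp (hmp 0).measurable).aemeasurable
      map_eq := by
        change Measure.map (H ∘ fun ω : ℕ → Ω => ω i) _ = Measure.map (H ∘ fun ω : ℕ → Ω => ω 0) _
        rw [← Measure.map_map hH (hmp i).measurable, ← Measure.map_map hH (hmp 0).measurable,
          (hmp i).map_eq, (hmp 0).map_eq] }
  have hint : ∫ ω : ℕ → Ω, H (ω 0) ∂(Measure.infinitePi fun _ => μ) = ∫ x, H x ∂μ := by
    have hH' : AEStronglyMeasurable H
        (Measure.map (fun ω : ℕ → Ω => ω 0) (Measure.infinitePi fun _ => μ)) := by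
      rw [(hmp 0).map_eq]; exact hi.aestronglyMeasurable
    rw [← integral_map (hmp 0).measurable.aemeasurable hH', (hmp 0).map_eq]
  have := strong_law_ae (fun i (ω : ℕ → Ω) => H (ω i)) ((hmp 0).integrable_comp_of_integrable hi)
    (fun i j hij => hindep.indepFun hij) hlaw
  obtain ⟨w, hw⟩ := this.exists
  exact ⟨w, hint ▸ hw⟩

lemma sum_range_mul_eq_sum_sum {E : Type*} [AddCommMonoid E] (g : ℕ → E) (n K : ℕ) :
    ∑ p ∈ Finset.range (n * K), g p =
      ∑ k ∈ Finset.range K, ∑ l ∈ Finset.range n, g (n * k + l) := by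
  induction K with
  | zero => simp
  | succ K ih => rw [Nat.mul_succ, Finset.sum_range_add, ih, Finset.sum_range_succ]

lemma shift_iterate_apply {M : Type*} {T : (ℤ → M) → ℤ → M}
    (hT : ∀ (x : ℤ → M) (i : ℤ), T x i = x (i - 1)) (j : ℕ) (x : ℤ → M) (i : ℤ) :
    T^[j] x i = x (i - j) := by
  induction j generalizing x with
  | zero => simp
  | succ j ih => rw [Function.iterate_succ_apply, ih, hT]; congr 1; push_cast; ring

/-- If two sequences are uniformly close on `range n` except for the first and last `m` indices, then
their sums over `range n` are close. -/
lemma norm_sum_sub_sum_le {E : Type*} [NormedAddCommGroup E] {u v : ℕ → E} {n m : ℕ} {η C : ℝ}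
    (hη : 0 ≤ η) (hC : ∀ l, ‖u l - v l‖ ≤ C)
    (h : ∀ l, m ≤ l → l + m < n → ‖u l - v l‖ ≤ η) :
    ‖∑ l ∈ Finset.range n, u l - ∑ l ∈ Finset.range n, v l‖ ≤ n * η + 2 * m * C := by
  have hC0 : 0 ≤ C := (norm_nonneg _).trans (hC 0)
  rw [← Finset.sum_sub_distrib]
  have hterm : ∀ l ∈ Finset.range n, ‖u l - v l‖ ≤
      η + ((if l < m then C else 0) + if n ≤ l + m then C else 0) := by
    intro l _
    by_cases h1 : l < m
    · have := hC l
      split_ifs <;> linarith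
    · by_cases h2 : n ≤ l + m
      · have := hC l
        split_ifs; linarith
      · have := h l (not_lt.1 h1) (not_le.1 h2)
        split_ifs; linarith
  have hcard1 : ((Finset.range n).filter (fun l => l < m)).card ≤ m := by
    calc _ ≤ (Finset.range m).card := Finset.card_le_card fun l hl => by
          simp only [Finset.mem_filter, Finset.mem_range] at hl ⊢; omega
      _ = m := Finset.card_range m
  have hcard2 : ((Finset.range n).filter (fun l => n ≤ l + m)).card ≤ m := by
    calc _ ≤ (Finset.Ico (n - m) n).card := Finset.card_le_card fun l hl => by
          simp only [Finset.mem_filter, Finset.mem_range, Finset.mem_Ico] at hl ⊢; omega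
      _ ≤ m := by rw [Nat.card_Ico]; omega
  calc _ ≤ ∑ l ∈ Finset.range n,
        (η + ((if l < m then C else 0) + if n ≤ l + m then C else 0)) :=
        norm_sum_le_of_le _ hterm
    _ = n * η + (((Finset.range n).filter (fun l => l < m)).card * C +
        ((Finset.range n).filter (fun l => n ≤ l + m)).card * C) := by
        simp [Finset.sum_add_distrib, ← Finset.sum_filter]
    _ ≤ n * η + (m * C + m * C) := by gcongr
    _ = _ := by ring

/-- For every shift-invariant probability measure on `M^ℤ` and every continuous vector-valued
function, there are periodic orbits of arbitrarily long period, with pairwise distinct coordinates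
within a period, along which the mean of the function is close to its integral. -/
lemma exists_periodic_average_near {M ι : Type*} [MetricSpace M] [CompactSpace M]
    (hM : Preperfect (Set.univ : Set M)) [MeasurableSpace (ℤ → M)] [BorelSpace (ℤ → M)]
    {T : (ℤ → M) → ℤ → M} (hT : ∀ (x : ℤ → M) (i : ℤ), T x i = x (i - 1))
    (μ : Measure (ℤ → M)) [IsProbabilityMeasure μ] (hμ : MeasurePreserving T μ μ)
    [Fintype ι] {G : (ℤ → M) → ι → ℝ} (hG : Continuous G) {ε : ℝ} (hε : 0 < ε) (N : ℕ) :
    ∃ (x : ℤ → M) (s : ℕ), 0 < s ∧ N ≤ s ∧ T^[s] x = x ∧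
      (∀ i j : ℕ, i < s → j < s → i ≠ j → x ((i : ℤ) + 1) ≠ x ((j : ℤ) + 1)) ∧
      ‖(s : ℝ)⁻¹ • ∑ i ∈ Finset.range s, G (T^[i] x) - ∫ z, G z ∂μ‖ < ε := by
  obtain ⟨m, δ, hδ, hwin⟩ := exists_window_dist_lt hG (show 0 < ε / 4 by positivity)
  obtain ⟨C, hC⟩ := isCompact_univ.exists_bound_of_continuousOn hG.continuousOn
  replace hC : ∀ z, ‖G z‖ ≤ C := fun z => hC z (Set.mem_univ z)
  obtain ⟨n, hn0, hn⟩ : ∃ n : ℕ, 0 < n ∧ 2 * m * (2 * C) ≤ n * (ε / 4) := by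
    obtain ⟨n, hn⟩ := exists_nat_ge (2 * m * (2 * C) / (ε / 4))
    refine ⟨n + 1, n.succ_pos, ?_⟩
    rw [div_le_iff₀ (by positivity)] at hn
    push_cast
    nlinarith
  have hTit : ∀ l : ℕ, MeasurePreserving T^[l] μ μ := fun l => hμ.iterate l
  have hGint : Integrable G μ := Integrable.of_bound hG.measurable.aestronglyMeasurable C
    (Eventually.of_forall hC)
  have hGTint : ∀ l : ℕ, Integrable (fun z => G (T^[l] z)) μ := fun l =>
    (hTit l).integrable_comp_of_integrable hGint
  have hGT : ∀ l : ℕ, ∫ z, G (T^[l] z) ∂μ = ∫ z, G z ∂μ := fun l => by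
    have h := integral_map (μ := μ) (φ := T^[l]) (f := G) (hTit l).measurable.aemeasurable
      hG.measurable.aestronglyMeasurable
    rw [(hTit l).map_eq] at h
    exact h.symm
  obtain ⟨w, hw⟩ := exists_seq_tendsto_average μ
    (H := fun z => ∑ l ∈ Finset.range n, G (T^[l] z))
    (Finset.measurable_fun_sum _ fun l _ => hG.measurable.comp (hTit l).measurable)
    (integrable_finsetSum _ fun l _ => hGTint l)
  have hH : ∫ z, ∑ l ∈ Finset.range n, G (T^[l] z) ∂μ = (n : ℝ) • ∫ z, G z ∂μ := by
    rw [integral_finsetSum _ fun l _ => hGTint l]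
    simp [hGT, ← Nat.cast_smul_eq_nsmul ℝ]
  rw [hH] at hw
  have hnR : (0 : ℝ) < n := by exact_mod_cast hn0
  obtain ⟨K, hK, hKN⟩ := ((hw.eventually (ball_mem_nhds _
    (show 0 < n * (ε / 4) by positivity))).and (eventually_ge_atTop (N + 1))).exists
  have hK0 : 0 < K := by omega
  have hKR : (0 : ℝ) < K := by exact_mod_cast hK0
  have hs0 : 0 < n * K := Nat.mul_pos hn0 hK0
  obtain ⟨y, hyinj, hy⟩ := exists_injOn_dist_lt hM (fun p => w (p / n) (-((p % n : ℕ) : ℤ))) hδ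
    (n * K)
  set s := n * K with hs
  have hsZ : (0 : ℤ) < s := by exact_mod_cast hs0
  let x : ℤ → M := fun i => y ((-i) % s).toNat
  have hx : ∀ (i : ℤ) (p : ℕ), p < s → -i ≡ p [ZMOD s] → x i = y p := by
    intro i p hp h
    have : (-i) % (s : ℤ) = p := by
      rw [h, Int.emod_eq_of_lt (by positivity) (by exact_mod_cast hp)]
    simp [x, this]
  have hblock : ∀ k < K, ‖∑ l ∈ Finset.range n, G (T^[n * k + l] x) -
      ∑ l ∈ Finset.range n, G (T^[l] (w k))‖ ≤ n * (ε / 4) + 2 * m * (2 * C) := by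
    intro k hk
    refine norm_sum_sub_sum_le (by positivity)
      (fun l => (norm_sub_le _ _).trans (by linarith [hC (T^[n * k + l] x), hC (T^[l] (w k))]))
      fun l hl hln => ?_
    rw [← dist_eq_norm]
    refine (hwin _ _ fun i hi => ?_).le
    rw [abs_le] at hi
    obtain ⟨q, hq⟩ : ∃ q : ℕ, (q : ℤ) = l - i := ⟨(l - i).toNat, by omega⟩
    have hqn : q < n := by omega
    have hlt : n * k + q < s := by
      calc n * k + q < n * k + n := by omega
        _ = n * (k + 1) := by ring
        _ ≤ s := Nat.mul_le_mul_left n hk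
    rw [shift_iterate_apply hT, shift_iterate_apply hT, hx _ (n * k + q) hlt]
    · have := hy (n * k + q)
      rw [Nat.mul_add_div hn0, Nat.div_eq_of_lt hqn, Nat.mul_add_mod, Nat.mod_eq_of_lt hqn, hq,
        add_zero, neg_sub] at this
      exact this
    · push_cast
      rw [hq]
      rw [show -(i - ((n : ℤ) * k + l)) = n * k + (l - i) by ring]
  refine ⟨x, s, hs0, ?_, ?_, ?_, ?_⟩
  · calc N ≤ K := by omega
      _ ≤ s := Nat.le_mul_of_pos_left K hn0
  · funext i
    rw [shift_iterate_apply hT]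
    simp only [x, neg_sub]
    rw [show (s : ℤ) - i = -i + s by ring, Int.add_emod_right]
  · intro i j hi hj hij h
    have hmem : ∀ a : ℤ, (a % s).toNat < s := fun a => by
      have := Int.emod_lt_of_pos a hsZ
      omega
    have h1 := hyinj (hmem _) (hmem _) h
    have h2 : (-((i : ℤ) + 1)) % s = (-((j : ℤ) + 1)) % s := by
      have := Int.emod_nonneg (-((i : ℤ) + 1)) hsZ.ne'
      have := Int.emod_nonneg (-((j : ℤ) + 1)) hsZ.ne'
      omega
    have h3 : (i : ℤ) ≡ j [ZMOD s] := by
      have h4 : -((i : ℤ) + 1) ≡ -((j : ℤ) + 1) [ZMOD s] := h2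
      exact (Int.ModEq.add_right_cancel' 1 (by simpa using h4.neg))
    exact hij (Nat.ModEq.eq_of_lt_of_lt (Int.natCast_modEq_iff.1 h3) hi hj)
  · set A := ∑ i ∈ Finset.range s, G (T^[i] x) with hA
    set B := ∑ k ∈ Finset.range K, ∑ l ∈ Finset.range n, G (T^[l] (w k)) with hB
    set I := ∫ z, G z ∂μ with hI
    have hAB : ‖A - B‖ ≤ s * (ε / 2) := by
      rw [hA, hB, hs, sum_range_mul_eq_sum_sum, ← Finset.sum_sub_distrib]
      calc _ ≤ ∑ k ∈ Finset.range K, (n * (ε / 4) + 2 * m * (2 * C)) :=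
            norm_sum_le_of_le _ fun k hk => hblock k (Finset.mem_range.1 hk)
        _ ≤ ∑ k ∈ Finset.range K, (n * (ε / 4) + n * (ε / 4)) := by gcongr
        _ = _ := by simp; ring
    have hBI : ‖(K : ℝ)⁻¹ • B - (n : ℝ) • I‖ < n * (ε / 4) := by
      rw [← dist_eq_norm]; exact hK
    have hsR : (s : ℝ) = n * K := by rw [hs]; push_cast; rfl
    have hdec : (s : ℝ)⁻¹ • A - I =
        (s : ℝ)⁻¹ • (A - B) + (n : ℝ)⁻¹ • ((K : ℝ)⁻¹ • B - (n : ℝ) • I) := by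
      rw [smul_sub, smul_sub, smul_smul, smul_smul, inv_mul_cancel₀ hnR.ne', one_smul, hsR,
        mul_inv]
      abel
    have hsR0 : (0 : ℝ) < s := by exact_mod_cast hs0
    rw [hdec]
    calc _ ≤ (s : ℝ)⁻¹ * ‖A - B‖ + (n : ℝ)⁻¹ * ‖(K : ℝ)⁻¹ • B - (n : ℝ) • I‖ := by
          refine (norm_add_le _ _).trans_eq ?_
          rw [norm_smul, norm_smul, norm_inv, norm_inv, Real.norm_natCast, Real.norm_natCast]
      _ ≤ (s : ℝ)⁻¹ * (s * (ε / 2)) + (n : ℝ)⁻¹ * (n * (ε / 4)) := by gcongr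
      _ = ε / 2 + ε / 4 := by field_simp
      _ < ε := by linarith

/-- The uniform measure on a periodic orbit of period `s`, counted with multiplicity. -/
noncomputable def orbitMeasure {X : Type*} [MeasurableSpace X] (T : X → X) (x : X) (s : ℕ) :
    Measure X :=
  (s : ℝ≥0∞)⁻¹ • ∑ i ∈ Finset.range s, Measure.dirac (T^[i] x)

lemma isProbabilityMeasure_orbitMeasure {X : Type*} [MeasurableSpace X] (T : X → X) (x : X)
    {s : ℕ} (hs : 0 < s) : IsProbabilityMeasure (orbitMeasure T x s) := by
  constructor
  simp only [orbitMeasure, Measure.smul_apply, Measure.finsetSum_apply, measure_univ, smul_eq_mul,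
    Finset.sum_const, Finset.card_range, nsmul_eq_mul, mul_one]
  exact ENNReal.inv_mul_cancel (by exact_mod_cast hs.ne') (ENNReal.natCast_ne_top s)

lemma orbitMeasure_preimage {X : Type*} [MeasurableSpace X] [MeasurableSingletonClass X]
    {T : X → X} {x : X} {s : ℕ} (hx : T^[s] x = x) (t : Set X) :
    orbitMeasure T x s (T ⁻¹' t) = orbitMeasure T x s t := by
  simp only [orbitMeasure, Measure.smul_apply, Measure.finsetSum_apply, Measure.dirac_apply]
  congr 1
  have h : ∀ i, (T ⁻¹' t).indicator (1 : X → ℝ≥0∞) (T^[i] x) =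
      t.indicator (1 : X → ℝ≥0∞) (T^[i + 1] x) := fun i => by
    rw [Function.iterate_succ_apply']; rfl
  simp only [h]
  rcases s with _ | s
  · simp
  · rw [Finset.sum_range_succ, Finset.sum_range_succ', hx]; rfl

lemma integral_orbitMeasure {X : Type*} [MeasurableSpace X] [MeasurableSingletonClass X]
    (T : X → X) (x : X) (s : ℕ) (f : X → ℝ) :
    ∫ z, f z ∂(orbitMeasure T x s) = (s : ℝ)⁻¹ * ∑ i ∈ Finset.range s, f (T^[i] x) := by
  rw [orbitMeasure, integral_smul_measure, integral_finsetSum_measure]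
  · simp
  · exact fun i _ => integrable_dirac (by simp)

/-- For the full shift on `X = M^ℤ` (with `M` perfect compact metric, `X`
bearing the metric `r(x,y) = ∑_{n∈ℤ} min (1/(n²+1)) (d(xₙ,yₙ))`), `μ ∈ M(T)` and `s₀ > 0`:
every weak neighborhood of `μ` in `M(T)` contains a `T`-periodic measure
`(1/s) ∑_{i<s} δ_{T^i x}` where `x` is a `T`-periodic point of period `s ≥ s₀` whose
coordinates `x_1, …, x_s` within one period are pairwise distinct. -/
theorem statement18 {M : Type*} [MetricSpace M] [CompactSpace M]
    (hperf : Perfect (Set.univ : Set M))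
    [mX : MetricSpace (ℤ → M)]
    (hr : ∀ x y : ℤ → M,
      dist x y = ∑' n : ℤ, min (1 / ((n : ℝ) ^ 2 + 1)) (dist (x n) (y n)))
    [MeasurableSpace (ℤ → M)] [BorelSpace (ℤ → M)]
    (T : (ℤ → M) → (ℤ → M)) (hT : ∀ (x : ℤ → M) (i : ℤ), T x i = x (i - 1))
    (μ : ProbabilityMeasure (ℤ → M)) (hμ : μ ∈ invSet T) (s₀ : ℝ) (hs₀ : 0 < s₀) :
    ∀ V ∈ 𝓝 μ, ∃ (ν : ProbabilityMeasure (ℤ → M)) (x : ℤ → M) (s : ℕ),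
      ν ∈ V ∧ ν ∈ invSet T ∧ 0 < s ∧ s₀ ≤ (s : ℝ) ∧ T^[s] x = x ∧
      (∀ i j : ℕ, i < s → j < s → i ≠ j → x ((i : ℤ) + 1) ≠ x ((j : ℤ) + 1)) ∧
      ν.toMeasure = (s : ℝ≥0∞)⁻¹ • ∑ i ∈ Finset.range s, Measure.dirac (T^[i] x) := by
  classical
  have hTc : Continuous T := continuous_pi fun i => by
    simpa only [hT] using continuous_apply (i - 1)
  have hmp : MeasurePreserving T μ.toMeasure μ.toMeasure :=
    ⟨hTc.measurable, Measure.ext fun t ht => by rw [Measure.map_apply hTc.measurable ht, hμ t ht]⟩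
  have key : ∀ p : Finset (BoundedContinuousFunction (ℤ → M) ℝ) × ℕ,
      ∃ (x : ℤ → M) (s : ℕ), 0 < s ∧ ⌈s₀⌉₊ ≤ s ∧ T^[s] x = x ∧
        (∀ i j : ℕ, i < s → j < s → i ≠ j → x ((i : ℤ) + 1) ≠ x ((j : ℤ) + 1)) ∧
        ∀ f ∈ p.1, |(s : ℝ)⁻¹ * ∑ i ∈ Finset.range s, f (T^[i] x) - ∫ z, f z ∂μ.toMeasure| <
          1 / ((p.2 : ℝ) + 1) := by
    rintro ⟨F, n⟩
    obtain ⟨x, s, hs, hsN, hx, hinj, hlt⟩ := exists_periodic_average_near hperf.acc hT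
      μ.toMeasure hmp (G := fun z (f : F) => f.1 z) (continuous_pi fun f => f.1.continuous)
      (Nat.one_div_pos_of_nat (α := ℝ) (n := n)) ⌈s₀⌉₊
    refine ⟨x, s, hs, hsN, hx, hinj, fun f hf => ?_⟩
    refine lt_of_le_of_lt ?_ hlt
    have h := norm_le_pi_norm ((s : ℝ)⁻¹ • ∑ i ∈ Finset.range s,
      (fun (f : F) => f.1 (T^[i] x)) - ∫ z, (fun (f : F) => f.1 z) ∂μ.toMeasure) ⟨f, hf⟩
    rwa [Pi.sub_apply, eval_integral fun g => g.1.integrable μ.toMeasure, Pi.smul_apply,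
      Finset.sum_apply, Real.norm_eq_abs, smul_eq_mul] at h
  choose x s hs hsN hx hinj hlt using key
  let ν : Finset (BoundedContinuousFunction (ℤ → M) ℝ) × ℕ → ProbabilityMeasure (ℤ → M) :=
    fun p => ⟨orbitMeasure T (x p) (s p), isProbabilityMeasure_orbitMeasure T (x p) (hs p)⟩
  have hν : Tendsto ν atTop (𝓝 μ) := by
    rw [ProbabilityMeasure.tendsto_iff_forall_integral_tendsto]
    intro f
    rw [Metric.tendsto_atTop]
    intro ε hε
    obtain ⟨n, hn⟩ := exists_nat_one_div_lt hε
    refine ⟨({f}, n), fun p hp => ?_⟩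
    have hf : f ∈ p.1 := hp.1 (Finset.mem_singleton_self f)
    have hint : ∫ z, f z ∂(ν p).toMeasure = _ := integral_orbitMeasure T (x p) (s p) f
    rw [Real.dist_eq, hint]
    exact (hlt p f hf).trans_le ((Nat.one_div_le_one_div hp.2).trans hn.le)
  intro V hV
  obtain ⟨p, hp⟩ := (hν.eventually hV).exists
  exact ⟨ν p, x p, s p, hp, fun t _ => orbitMeasure_preimage (hx p) t, hs p,
    (Nat.le_ceil s₀).trans (by exact_mod_cast hsN p), hx p, hinj p, rfl⟩
end

section
/- Let M be a perfect compact metric space, let X = M^ℤ be endowed with the metric r(x,y) = Σ_{n∈ℤ} min{1/(n²+1), d(x_n,y_n)}, and let T be the full shift on X. Let μ ∈ M(T) and q > 1. Then every weak neighborhood V of μ in M(T) contains a measure ρ ∈ M(T) with D⁺_ρ(q) = +∞. -/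
open MeasureTheory Filter Topology Metric Set
open scoped ENNReal NNReal

section Energy

variable {X : Type*} [MetricSpace X] [SecondCountableTopology X] [MeasurableSpace X]
  [OpensMeasurableSpace X]

omit [OpensMeasurableSpace X] in
lemma ae_mem_msupp (ρ : Measure X) : ∀ᵐ x ∂ρ, x ∈ msupp ρ := by
  filter_upwards [Measure.support_mem_ae (μ := ρ)] with x hx ε hε
  exact (Measure.mem_support_iff_forall x).1 hx _ (ball_mem_nhds x hε)

lemma measurable_measure_ball (ρ : Measure X) [SFinite ρ] (ε : ℝ) :
    Measurable fun x => ρ (ball x ε) := by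
  have hs : MeasurableSet {p : X × X | dist p.2 p.1 < ε} :=
    (isOpen_lt (by fun_prop) (by fun_prop)).measurableSet
  exact measurable_measure_prodMk_left hs

lemma energyI_pos_and_le (ρ : Measure X) [IsProbabilityMeasure ρ] {q ε c : ℝ} (hq : 1 < q)
    (hε : 0 < ε) (hc : ∀ x, (ρ (ball x ε)).toReal ≤ c) :
    0 < energyI ρ q ε ∧ energyI ρ q ε ≤ c ^ (q - 1) := by
  have hq' : 0 ≤ q - 1 := by linarith
  have hle : ∀ x, (ρ (ball x ε)).toReal ^ (q - 1) ≤ c ^ (q - 1) := fun x =>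
    Real.rpow_le_rpow ENNReal.toReal_nonneg (hc x) hq'
  have hnn : ∀ x, 0 ≤ (ρ (ball x ε)).toReal ^ (q - 1) := fun x =>
    Real.rpow_nonneg ENNReal.toReal_nonneg _
  have hint : Integrable (fun x => (ρ (ball x ε)).toReal ^ (q - 1)) ρ := by
    refine Integrable.of_bound
      ((measurable_measure_ball ρ ε).ennreal_toReal.pow_const _).aestronglyMeasurable
      (c ^ (q - 1)) (ae_of_all _ fun x => ?_)
    rw [Real.norm_of_nonneg (hnn x)]
    exact hle x
  unfold energyI
  rw [Measure.restrict_eq_self_of_ae_mem (ae_mem_msupp ρ)]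
  constructor
  · rw [integral_pos_iff_support_of_nonneg_ae (ae_of_all _ hnn) hint]
    have : Function.support (fun x => (ρ (ball x ε)).toReal ^ (q - 1)) ∈ ae ρ := by
      filter_upwards [ae_mem_msupp ρ] with x hx
      exact (Real.rpow_pos_of_pos
        (ENNReal.toReal_pos (hx ε hε).ne' (measure_ne_top _ _)) _).ne'
    rw [(prob_compl_eq_zero_iff₀ (NullMeasurableSet.of_compl
      (NullMeasurableSet.of_null this))).1 this]
    exact one_pos
  · calc ∫ x, (ρ (ball x ε)).toReal ^ (q - 1) ∂ρ ≤ ∫ _, c ^ (q - 1) ∂ρ :=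
          integral_mono hint (integrable_const _) hle
      _ = c ^ (q - 1) := by simp

lemma tendsto_div_log_sq_add_one :
    Tendsto (fun k : ℕ => (k * Real.log 2) / Real.log ((k : ℝ) ^ 2 + 1)) atTop atTop := by
  have h1 : Tendsto (fun k : ℕ => ((k : ℝ) + 1) / Real.log ((k : ℝ) + 1)) atTop atTop := by
    have h := Real.isLittleO_log_id_atTop.tendsto_div_nhds_zero
    have h' : Tendsto (fun x : ℝ => Real.log x / x) atTop (𝓝[>] 0) := by
      refine tendsto_nhdsWithin_iff.2 ⟨h, ?_⟩
      filter_upwards [eventually_gt_atTop (1 : ℝ)] with x hx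
      exact div_pos (Real.log_pos hx) (by linarith)
    have := h'.inv_tendsto_nhdsGT_zero.comp
      (tendsto_atTop_add_const_right _ 1 (tendsto_natCast_atTop_atTop (R := ℝ)))
    refine this.congr fun k => ?_
    simp
  refine tendsto_atTop_mono' _ ?_ (h1.const_mul_atTop (r := Real.log 2 / 4)
    (by have := Real.log_pos one_lt_two; positivity))
  filter_upwards [eventually_ge_atTop 1] with k hk
  have hk' : (1 : ℝ) ≤ k := by exact_mod_cast hk
  have hl2 := Real.log_pos one_lt_two
  have hlog : Real.log ((k : ℝ) ^ 2 + 1) ≤ 2 * Real.log ((k : ℝ) + 1) := by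
    have : 2 * Real.log ((k : ℝ) + 1) = Real.log (((k : ℝ) + 1) ^ 2) := by
      rw [Real.log_pow]; norm_num
    rw [this]
    exact Real.log_le_log (by positivity) (by nlinarith)
  have hpos : 0 < Real.log ((k : ℝ) ^ 2 + 1) := Real.log_pos (by nlinarith)
  have hpos' : 0 < Real.log ((k : ℝ) + 1) := Real.log_pos (by linarith)
  calc Real.log 2 / 4 * (((k : ℝ) + 1) / Real.log (k + 1))
      = ((k + 1) / 2 * Real.log 2) / (2 * Real.log (k + 1)) := by field_simp; norm_num
    _ ≤ (k * Real.log 2) / (2 * Real.log (k + 1)) := by gcongr; linarith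
    _ ≤ _ := by gcongr

lemma Dupper_eq_top_of_measure_ball_le (ρ : Measure X) [IsProbabilityMeasure ρ] {q : ℝ}
    (hq : 1 < q) (hρ : ∀ᶠ k : ℕ in atTop, ∀ x,
      (ρ (ball x (1 / ((k : ℝ) ^ 2 + 1)))).toReal ≤ (1 / 2 : ℝ) ^ k) :
    Dupper ρ q = ⊤ := by
  set u : ℕ → ℝ := fun k => 1 / ((k : ℝ) ^ 2 + 1)
  have hu : Tendsto u atTop (𝓝[>] 0) := by
    refine tendsto_nhdsWithin_iff.2 ⟨?_, Eventually.of_forall fun k => ?_⟩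
    · refine squeeze_zero (fun k => by positivity) (fun k => ?_)
        tendsto_one_div_add_atTop_nhds_zero_nat
      refine one_div_le_one_div_of_le (by positivity) ?_
      have : (k : ℝ) ≤ (k : ℝ) ^ 2 := by exact_mod_cast Nat.le_self_pow two_ne_zero k
      linarith
    · exact mem_Ioi.2 (by positivity)
  set F : ℝ → ℝ := fun ε => Real.log (energyI ρ q ε) / ((q - 1) * Real.log ε)
  have hF : Tendsto (fun k => F (u k)) atTop atTop := by
    refine tendsto_atTop_mono' _ ?_ tendsto_div_log_sq_add_one
    filter_upwards [hρ, eventually_ge_atTop 1] with k hk hk1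
    obtain ⟨hpos, hle⟩ := energyI_pos_and_le ρ hq (by positivity) hk
    have hk' : (1 : ℝ) ≤ k := by exact_mod_cast hk1
    have hlog : 0 < Real.log ((k : ℝ) ^ 2 + 1) := Real.log_pos (by nlinarith)
    have hq0 : 0 < q - 1 := by linarith
    have h := Real.log_le_log hpos hle
    rw [Real.log_rpow (by positivity), Real.log_pow, one_div 2, Real.log_inv] at h
    have hu' : Real.log (u k) = -Real.log ((k : ℝ) ^ 2 + 1) := by
      simp only [u, one_div, Real.log_inv]
    change _ ≤ Real.log (energyI ρ q (u k)) / ((q - 1) * Real.log (u k))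
    rw [hu', mul_neg, div_neg, ← neg_div, div_le_div_iff₀ hlog (by positivity)]
    have : (q - 1) * (k * Real.log 2) ≤ -Real.log (energyI ρ q (u k)) := by
      simp only [u]; linarith
    nlinarith
  have h1 : limsup (fun ε => (F ε : EReal)) (map u atTop) = ⊤ :=
    Tendsto.limsup_eq (tendsto_map'_iff.2
      (EReal.tendsto_coe_nhds_top_iff (f := fun k => F (u k)).2 hF))
  exact top_le_iff.1 (h1 ▸ limsup_le_limsup_of_le hu)

end Energy

section Perturbation

variable {M : Type*} [MetricSpace M] [MeasurableSpace M] [BorelSpace M]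

lemma exists_measurable_pair_near [CompactSpace M] [Nonempty M]
    (hperf : Perfect (univ : Set M)) {η : ℝ} (hη : 0 < η) :
    ∃ φ : M → Bool → M, (∀ b, Measurable fun m => φ m b) ∧ (∀ m b, dist (φ m b) m < η) ∧
      ∃ δ > 0, ∀ m, δ ≤ dist (φ m true) (φ m false) := by
  have hη2 : 0 < η / 2 := by linarith
  obtain ⟨t, ht⟩ := isCompact_univ.elim_finite_subcover
    (fun n : ℕ => ball (TopologicalSpace.denseSeq M n) (η / 2)) (fun _ => isOpen_ball)
    (fun m _ => by
      obtain ⟨n, hn⟩ := (TopologicalSpace.denseRange_denseSeq M).exists_dist_lt m hη2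
      exact mem_iUnion.2 ⟨n, hn⟩)
  set g := SimpleFunc.nearestPt (TopologicalSpace.denseSeq M) (t.sup id)
  have hg : ∀ m, dist (g m) m < η / 2 := by
    intro m
    obtain ⟨n, hn, hm⟩ := mem_iUnion₂.1 (ht (mem_univ m))
    have h := SimpleFunc.edist_nearestPt_le (TopologicalSpace.denseSeq M) m
      (Finset.le_sup (f := id) hn)
    rw [edist_dist, edist_dist, ENNReal.ofReal_le_ofReal_iff dist_nonneg] at h
    exact h.trans_lt (by rwa [dist_comm])
  have hb : ∀ p : M, ∃ p', dist p' p < η / 2 ∧ p' ≠ p := by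
    intro p
    obtain ⟨y, hy, hne⟩ :=
      accPt_iff_nhds.1 (hperf.acc p (mem_univ p)) _ (ball_mem_nhds p hη2)
    exact ⟨y, hy.1, hne⟩
  choose b hb hbne using hb
  refine ⟨fun m c => if c then g m else b (g m), ?_, ?_, ?_⟩
  · rintro (_ | _)
    · exact (g.map b).measurable
    · simpa using g.measurable
  · rintro m (_ | _)
    · have := dist_triangle (b (g m)) (g m) m
      have := hb (g m)
      have := hg m
      simp only [Bool.false_eq_true, if_false]
      linarith
    · have := hg m
      simp only [if_true]
      linarith
  · have : ∀ᶠ δ in 𝓝[>] (0 : ℝ), ∀ p ∈ g.range, δ ≤ dist p (b p) := by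
      refine (Filter.eventually_all_finset _).2 fun p _ => ?_
      exact eventually_nhdsWithin_of_eventually_nhds
        (eventually_le_nhds (dist_pos.2 (hbne p).symm))
    obtain ⟨δ, hδ, hδ0⟩ := (this.and self_mem_nhdsWithin).exists
    exact ⟨δ, hδ0, fun m => by simpa using hδ (g m) (g.mem_range_self m)⟩

/-- The law of a bi-infinite sequence of independent fair coin tosses. -/
noncomputable def coinLaw : Measure (ℤ → Bool) :=
  Measure.infinitePi fun _ => (PMF.uniformOfFintype Bool).toMeasure

instance : IsProbabilityMeasure coinLaw := by unfold coinLaw; infer_instance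

lemma coinLaw_forall_mem_eq (s : Finset ℤ) (c : ℤ → Bool) :
    coinLaw {ω | ∀ i ∈ s, ω i = c i} = (1 / 2) ^ s.card := by
  have : {ω : ℤ → Bool | ∀ i ∈ s, ω i = c i} = Set.pi s fun i => {c i} := by
    ext; simp [Set.mem_pi]
  rw [this, coinLaw, Measure.infinitePi_pi _ fun _ _ => measurableSet_singleton _]
  simp

lemma measurePreserving_shift_coinLaw :
    MeasurePreserving (fun (ω : ℤ → Bool) i => ω (i - 1)) coinLaw coinLaw := by
  refine ⟨by fun_prop, ?_⟩
  unfold coinLaw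
  have := Measure.infinitePi_map_piCongrLeft
    (fun _ : ℤ => (PMF.uniformOfFintype Bool).toMeasure) (Equiv.addRight (1 : ℤ))
  convert this using 2
  funext ω i
  have h := Equiv.piCongrLeft_apply_apply (fun _ : ℤ => Bool) (Equiv.addRight (1 : ℤ)) ω (i - 1)
  simp only [Equiv.coe_addRight, sub_add_cancel] at h
  exact h.symm

/-- Replace every coordinate `x n` by `φ (x n) (ω n)`. -/
def perturb (φ : M → Bool → M) (p : (ℤ → M) × (ℤ → Bool)) : ℤ → M := fun n => φ (p.1 n) (p.2 n)

omit [MetricSpace M] [BorelSpace M] in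
lemma measurable_perturb {φ : M → Bool → M} (hφ : ∀ b, Measurable fun m => φ m b) :
    Measurable (perturb φ) := by
  have : Measurable (Function.uncurry φ) := measurable_from_prod_countable_left hφ
  refine measurable_pi_iff.2 fun n => ?_
  exact this.comp (f := fun p : (ℤ → M) × (ℤ → Bool) => (p.1 n, p.2 n)) (by fun_prop)

lemma measure_perturb_cylinder_le {φ : M → Bool → M} (hφ : ∀ b, Measurable fun m => φ m b)
    {δ ε : ℝ} (hδ : ∀ m, δ ≤ dist (φ m true) (φ m false)) (hε : 2 * ε ≤ δ)
    (μ : Measure (ℤ → M)) [IsProbabilityMeasure μ] (z : ℤ → M) (s : Finset ℤ) :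
    (μ.prod coinLaw).map (perturb φ) {y | ∀ i ∈ s, dist (y i) (z i) < ε} ≤ (1 / 2) ^ s.card := by
  have hms : MeasurableSet {y : ℤ → M | ∀ i ∈ s, dist (y i) (z i) < ε} := by
    have : {y : ℤ → M | ∀ i ∈ s, dist (y i) (z i) < ε} = Set.pi s fun i => ball (z i) ε := by
      ext; simp [Set.mem_pi]
    rw [this]
    exact MeasurableSet.pi s.countable_toSet fun i _ => measurableSet_ball
  rw [Measure.map_apply (measurable_perturb hφ) hms,
    Measure.prod_apply (measurable_perturb hφ hms)]
  refine (lintegral_mono (g := fun _ => (1 / 2 : ℝ≥0∞) ^ s.card) fun x => ?_).trans (by simp)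
  classical
  rw [← coinLaw_forall_mem_eq s fun i => decide (dist (φ (x i) true) (z i) < ε)]
  refine measure_mono fun ω hω i hi => ?_
  have h : dist (φ (x i) (ω i)) (z i) < ε := hω i hi
  cases hc : ω i with
  | true => simpa [hc] using h
  | false =>
    rw [hc] at h
    have := hδ (x i)
    have := dist_triangle_right (φ (x i) true) (φ (x i) false) (z i)
    symm
    rw [decide_eq_false_iff_not, not_lt]
    linarith

omit [MetricSpace M] [BorelSpace M] in
lemma map_perturb_invariant {φ : M → Bool → M} (hφ : ∀ b, Measurable fun m => φ m b)
    {T : (ℤ → M) → (ℤ → M)} (hT : ∀ (x : ℤ → M) (i : ℤ), T x i = x (i - 1))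
    {μ : Measure (ℤ → M)} [IsProbabilityMeasure μ] (hμ : IsInvariantMeasure T μ) :
    IsInvariantMeasure T ((μ.prod coinLaw).map (perturb φ)) := by
  have hTm : Measurable T := measurable_pi_iff.2 fun i => by
    simp only [hT]; fun_prop
  have hTμ : MeasurePreserving T μ μ :=
    ⟨hTm, Measure.ext fun s hs => by rw [Measure.map_apply hTm hs, hμ s hs]⟩
  have hm := measurable_perturb hφ
  have hprod := hTμ.prod measurePreserving_shift_coinLaw
  intro s hs
  rw [Measure.map_apply hm (hTm hs), Measure.map_apply hm hs,
    ← hprod.measure_preimage (hm hs).nullMeasurableSet]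
  congr 1
  ext p
  have : T (perturb φ p) = perturb φ (Prod.map T (fun ω i => ω (i - 1)) p) := by
    funext i
    simp [perturb, hT]
  simp only [mem_preimage, this]

lemma tendsto_map_perturb [SecondCountableTopology M] {φ : ℕ → M → Bool → M}
    (hφ : ∀ k b, Measurable fun m => φ k m b) {η : ℕ → ℝ} (hη : Tendsto η atTop (𝓝 0))
    (hd : ∀ k m b, dist (φ k m b) m < η k) (μ : ProbabilityMeasure (ℤ → M))
    {ρ : ℕ → ProbabilityMeasure (ℤ → M)}
    (hρ : ∀ k, (ρ k).toMeasure = (μ.toMeasure.prod coinLaw).map (perturb (φ k))) :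
    Tendsto ρ atTop (𝓝 μ) := by
  rw [ProbabilityMeasure.tendsto_iff_forall_integral_tendsto]
  intro f
  have hf : StronglyMeasurable f := f.continuous.measurable.stronglyMeasurable
  have h1 : ∀ k, ∫ y, f y ∂(ρ k).toMeasure
      = ∫ p, f (perturb (φ k) p) ∂(μ.toMeasure.prod coinLaw) := fun k => by
    rw [hρ, integral_map (measurable_perturb (hφ k)).aemeasurable hf.aestronglyMeasurable]
  have h2 : ∫ y, f y ∂μ.toMeasure = ∫ p, f p.1 ∂(μ.toMeasure.prod coinLaw) := by
    rw [integral_fun_fst (μ := μ.toMeasure) (ν := coinLaw) f]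
    simp
  simp only [h1, h2]
  refine tendsto_integral_of_dominated_convergence (fun _ => ‖f‖)
    (fun k => (hf.comp_measurable (measurable_perturb (hφ k))).aestronglyMeasurable)
    (integrable_const _) (fun k => ae_of_all _ fun p => f.norm_coe_le_norm _)
    (ae_of_all _ fun p => ?_)
  refine (f.continuous.tendsto p.1).comp (tendsto_pi_nhds.2 fun n => ?_)
  exact tendsto_iff_dist_tendsto_zero.2
    (squeeze_zero (fun _ => dist_nonneg) (fun k => (hd k _ _).le) hη)

end Perturbation

section SumMetric

variable {M : Type*} [MetricSpace M]

lemma summable_one_div_int_sq_add_one : Summable fun n : ℤ => 1 / ((n : ℝ) ^ 2 + 1) := by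
  refine Summable.of_norm_bounded_eventually
    ((Real.summable_one_div_int_pow (p := 2)).2 one_lt_two) ?_
  filter_upwards [(Set.finite_singleton (0 : ℤ)).compl_mem_cofinite] with n hn
  have hn' : (n : ℝ) ≠ 0 := by exact_mod_cast hn
  rw [Real.norm_of_nonneg (by positivity)]
  exact one_div_le_one_div_of_le (by positivity) (by linarith)

variable {mX : MetricSpace (ℤ → M)}
  (hr : ∀ x y : ℤ → M, mX.dist x y = ∑' n : ℤ, min (1 / ((n : ℝ) ^ 2 + 1)) (dist (x n) (y n)))

include hr

lemma min_le_sum_dist (x y : ℤ → M) (n : ℤ) :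
    min (1 / ((n : ℝ) ^ 2 + 1)) (dist (x n) (y n)) ≤ mX.dist x y := by
  rw [hr]
  have hnn : ∀ i : ℤ, 0 ≤ min (1 / ((i : ℝ) ^ 2 + 1)) (dist (x i) (y i)) := fun i => by
    positivity
  exact (summable_one_div_int_sq_add_one.of_nonneg_of_le hnn fun _ => min_le_left _ _).le_tsum n
    fun i _ => hnn i

lemma sum_dist_topology_eq :
    mX.toPseudoMetricSpace.toUniformSpace.toTopologicalSpace = Pi.topologicalSpace := by
  refine le_antisymm ?_ ?_
  · refine le_of_nhds_le_nhds fun x => ?_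
    rw [nhds_pi, Filter.le_pi]
    intro n
    refine ((@Metric.nhds_basis_ball _ mX.toPseudoMetricSpace x).tendsto_iff
      Metric.nhds_basis_ball).2 fun ε hε => ?_
    refine ⟨min (1 / ((n : ℝ) ^ 2 + 1)) ε, by positivity, fun y hy => ?_⟩
    have := (min_le_sum_dist hr y x n).trans_lt hy
    rcases min_lt_iff.1 this with h | h
    · exact absurd (h.trans_le (min_le_left _ _)) (lt_irrefl _)
    · exact h.trans_le (min_le_right _ _)
  · refine le_of_nhds_le_nhds fun x => ?_
    have hc : Continuous fun y : ℤ → M =>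
        ∑' n : ℤ, min (1 / ((n : ℝ) ^ 2 + 1)) (dist (y n) (x n)) := by
      refine continuous_tsum (fun n => by fun_prop) summable_one_div_int_sq_add_one fun n y => ?_
      rw [Real.norm_of_nonneg (by positivity)]
      exact min_le_left _ _
    have := hc.tendsto x
    have h0 : ∑' n : ℤ, min (1 / ((n : ℝ) ^ 2 + 1)) (dist (x n) (x n)) = 0 := by
      rw [← hr]; exact dist_self x
    rw [h0] at this
    refine (@Metric.nhds_basis_ball _ mX.toPseudoMetricSpace x).ge_iff.2 fun ε hε => ?_
    filter_upwards [this.eventually (eventually_lt_nhds hε)] with y hy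
    exact (hr y x).trans_lt hy

lemma sum_ball_subset_cylinder (x : ℤ → M) (k : ℕ) :
    @ball _ mX.toPseudoMetricSpace x (1 / ((k : ℝ) ^ 2 + 1)) ⊆
      {y | ∀ i ∈ Finset.Icc (1 : ℤ) k, dist (y i) (x i) < 1 / ((k : ℝ) ^ 2 + 1)} := by
  intro y hy i hi
  obtain ⟨h1, h2⟩ := Finset.mem_Icc.1 hi
  have := (min_le_sum_dist hr y x i).trans_lt hy
  rcases min_lt_iff.1 this with h | h
  · have h1' : (1 : ℝ) ≤ i := by exact_mod_cast h1
    have h2' : (i : ℝ) ≤ k := by exact_mod_cast h2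
    refine absurd h (not_lt.2 (one_div_le_one_div_of_le (by positivity) ?_))
    nlinarith
  · exact h

end SumMetric

lemma Dupper_map_perturb_eq_top {M : Type*} [MetricSpace M] [SecondCountableTopology M]
    [MeasurableSpace M] [BorelSpace M] {mX : MetricSpace (ℤ → M)}
    (hr : ∀ x y : ℤ → M,
      mX.dist x y = ∑' n : ℤ, min (1 / ((n : ℝ) ^ 2 + 1)) (dist (x n) (y n)))
    {φ : M → Bool → M} (hφ : ∀ b, Measurable fun m => φ m b) {δ : ℝ} (hδ0 : 0 < δ)
    (hδ : ∀ m, δ ≤ dist (φ m true) (φ m false)) (μ : Measure (ℤ → M)) [IsProbabilityMeasure μ]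
    {q : ℝ} (hq : 1 < q) : Dupper ((μ.prod coinLaw).map (perturb φ)) q = ⊤ := by
  have htop := sum_dist_topology_eq hr
  have hsc : @SecondCountableTopology (ℤ → M)
      mX.toPseudoMetricSpace.toUniformSpace.toTopologicalSpace := by
    rw [htop]; infer_instance
  have hom : @OpensMeasurableSpace (ℤ → M)
      mX.toPseudoMetricSpace.toUniformSpace.toTopologicalSpace MeasurableSpace.pi := by
    rw [htop]; infer_instance
  have hprob : IsProbabilityMeasure ((μ.prod coinLaw).map (perturb φ)) :=
    Measure.isProbabilityMeasure_map (measurable_perturb hφ).aemeasurable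
  refine @Dupper_eq_top_of_measure_ball_le _ mX hsc _ hom _ hprob q hq ?_
  have hu : Tendsto (fun k : ℕ => 1 / ((k : ℝ) + 1)) atTop (𝓝 0) :=
    tendsto_one_div_add_atTop_nhds_zero_nat
  filter_upwards [hu.eventually (eventually_le_nhds (half_pos hδ0))] with k hk x
  have hk2 : 1 / ((k : ℝ) ^ 2 + 1) ≤ 1 / ((k : ℝ) + 1) := by
    refine one_div_le_one_div_of_le (by positivity) ?_
    have : (k : ℝ) ≤ (k : ℝ) ^ 2 := by exact_mod_cast Nat.le_self_pow two_ne_zero k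
    linarith
  have h := (measure_mono (sum_ball_subset_cylinder hr x k)).trans
    (measure_perturb_cylinder_le hφ hδ (by linarith) μ x (Finset.Icc (1 : ℤ) k))
  have h' := ENNReal.toReal_mono (by simp) h
  simpa using h'

/-- For the full shift on `X = M^ℤ` (with `M` perfect compact metric, `X`
bearing the metric `r(x,y) = ∑_{n∈ℤ} min (1/(n²+1)) (d(xₙ,yₙ))`), `μ ∈ M(T)` and `q > 1`:
every weak neighborhood of `μ` in `M(T)` contains a measure `ρ ∈ M(T)` with
`D⁺_ρ(q) = +∞`. -/
theorem statement19 {M : Type*} [MetricSpace M] [CompactSpace M]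
    (hperf : Perfect (Set.univ : Set M))
    [mX : MetricSpace (ℤ → M)]
    (hr : ∀ x y : ℤ → M,
      dist x y = ∑' n : ℤ, min (1 / ((n : ℝ) ^ 2 + 1)) (dist (x n) (y n)))
    [MeasurableSpace (ℤ → M)] [BorelSpace (ℤ → M)]
    (T : (ℤ → M) → (ℤ → M)) (hT : ∀ (x : ℤ → M) (i : ℤ), T x i = x (i - 1))
    (μ : ProbabilityMeasure (ℤ → M)) (hμ : μ ∈ invSet T) (q : ℝ) (hq : 1 < q) :
    ∀ V ∈ 𝓝 μ, ∃ ρ : ProbabilityMeasure (ℤ → M),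
      ρ ∈ V ∧ ρ ∈ invSet T ∧ Dupper ρ.toMeasure q = (⊤ : EReal) := by
  rename_i mS hB
  borelize M
  obtain rfl : mS = MeasurableSpace.pi :=
    hB.measurable_eq.trans (Pi.borelSpace (X := fun _ : ℤ => M)).measurable_eq.symm
  have : Nonempty (ℤ → M) := μ.nonempty
  have : Nonempty M := this.map fun x => x 0
  choose φ hφ hd δ hδ0 hδ using fun k : ℕ =>
    exists_measurable_pair_near hperf (Nat.one_div_pos_of_nat (α := ℝ) (n := k))
  set ρ : ℕ → ProbabilityMeasure (ℤ → M) := fun k =>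
    ⟨(μ.toMeasure.prod coinLaw).map (perturb (φ k)),
      Measure.isProbabilityMeasure_map (measurable_perturb (hφ k)).aemeasurable⟩
  intro V hV
  have hρ : Tendsto ρ atTop (𝓝 μ) :=
    tendsto_map_perturb hφ tendsto_one_div_add_atTop_nhds_zero_nat hd μ fun _ => rfl
  obtain ⟨k, hk⟩ := (hρ.eventually_mem hV).exists
  exact ⟨ρ k, hk, map_perturb_invariant (hφ k) hT hμ,
    Dupper_map_perturb_eq_top hr (hφ k) (hδ0 k) (hδ k) μ.toMeasure hq⟩
end
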